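/- For t = 1, …, T let x_t, x_{p_t}, x_{q_t} ∈ ℝ^d all have Euclidean norm at most R, let L_1, …, L_T ∈ ℝ^{r×d} and L* ∈ ℝ^{r×d} have Frobenius norm at most U, and let α, ξ ∈ [0, 1]. Suppose for every t: the loss 1 + ‖L_t(x_t − x_{p_t})‖₂² − ‖L_t(x_t − x_{q_t})‖₂² is nonnegative, ⟨L_t x_t, L_t x_{p_t}⟩ ≥ 0, ⟨L_t x_t, L_t x_{q_t}⟩ ≤ 0, ⟨L* x_t, L* x_{p_t}⟩ ≤ α‖L* x_t‖₂‖L* x_{p_t}‖₂, and ⟨L* x_t, L* x_{q_t}⟩ ≥ −ξ‖L* x_t‖₂‖L* x_{q_t}‖₂. Define G_t(L) = max(0, 1 + ‖L(x_t − x_{p_t})‖₂² − ‖L(x_t − x_{q_t})‖₂²). Then the regret R(L*, T) = Σ_{t=1}^{T} G_t(L_t) − Σ_{t=1}^{T} G_t(L*) satisfies R(L*, T) ≤ 2T(α + ξ + 1)R²U². (Theorem 4, regret bound for OPML) -/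

import Mathlib

/-- The Euclidean (ℓ₂) norm of a vector in `ℝ^d`. -/
noncomputable def euclNorm {d : ℕ} (v : Fin d → ℝ) : ℝ := Real.sqrt (∑ i, v i ^ 2)

/-- The Frobenius norm of a real matrix. -/
noncomputable def frobNorm {m n : ℕ} (A : Matrix (Fin m) (Fin n) ℝ) : ℝ :=
  Real.sqrt (∑ i, ∑ j, A i j ^ 2)

/-- The Euclidean inner product on `ℝ^r`. -/
def edot {r : ℕ} (v w : Fin r → ℝ) : ℝ := ∑ i, v i * w i

theorem euclNorm_nonneg {d : ℕ} (v : Fin d → ℝ) : 0 ≤ euclNorm v := Real.sqrt_nonneg _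

theorem euclNorm_sq {d : ℕ} (v : Fin d → ℝ) : euclNorm v ^ 2 = ∑ i, v i ^ 2 :=
  Real.sq_sqrt (Finset.sum_nonneg fun _ _ => sq_nonneg _)

theorem euclNorm_mulVec_sub_sq {r d : ℕ} (A : Matrix (Fin r) (Fin d) ℝ) (v w : Fin d → ℝ) :
    euclNorm (A.mulVec (v - w)) ^ 2 =
      euclNorm (A.mulVec v) ^ 2 - 2 * edot (A.mulVec v) (A.mulVec w)
        + euclNorm (A.mulVec w) ^ 2 := by
  rw [Matrix.mulVec_sub]
  simp only [euclNorm_sq, edot, Finset.mul_sum, ← Finset.sum_sub_distrib, ← Finset.sum_add_distrib,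
    Pi.sub_apply]
  exact Finset.sum_congr rfl fun i _ => by ring

theorem euclNorm_mulVec_le {r d : ℕ} (A : Matrix (Fin r) (Fin d) ℝ) (v : Fin d → ℝ) :
    euclNorm (A.mulVec v) ≤ frobNorm A * euclNorm v := by
  unfold euclNorm frobNorm
  have hA : 0 ≤ ∑ i, ∑ j, A i j ^ 2 :=
    Finset.sum_nonneg fun _ _ => Finset.sum_nonneg fun _ _ => sq_nonneg _
  refine le_trans ?_ (Real.sqrt_mul hA _).le
  apply Real.sqrt_le_sqrt
  rw [Finset.sum_mul]
  refine Finset.sum_le_sum fun i _ => ?_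
  have h := Finset.sum_mul_sq_le_sq_mul_sq Finset.univ (fun j => A i j) v
  exact h

theorem euclNorm_mulVec_le' {r d : ℕ} {A : Matrix (Fin r) (Fin d) ℝ} {v : Fin d → ℝ} {R U : ℝ}
    (hA : frobNorm A ≤ U) (hv : euclNorm v ≤ R) : euclNorm (A.mulVec v) ≤ U * R :=
  (euclNorm_mulVec_le A v).trans
    (mul_le_mul hA hv (euclNorm_nonneg v) ((Real.sqrt_nonneg _).trans hA))

/-- **Theorem 4** (OPML paper, regret bound). With triplet hinge losses
`G_t(L) = max(0, 1 + ‖L(x_t - x_{p_t})‖² - ‖L(x_t - x_{q_t})‖²)`, under the stated norm,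
nonnegative-loss and angle conditions, the regret
`R(L*, T) = Σ_t G_t(L_t) - Σ_t G_t(L*)` satisfies `R(L*, T) ≤ 2T(α + ξ + 1) R² U²`. -/
theorem stmt_14 {d r T : ℕ} (R U α ξ : ℝ)
    (x p q : Fin T → Fin d → ℝ)
    (hx : ∀ t, euclNorm (x t) ≤ R) (hp : ∀ t, euclNorm (p t) ≤ R) (hq : ∀ t, euclNorm (q t) ≤ R)
    (Lseq : Fin T → Matrix (Fin r) (Fin d) ℝ) (Lstar : Matrix (Fin r) (Fin d) ℝ)
    (hL : ∀ t, frobNorm (Lseq t) ≤ U) (hLstar : frobNorm Lstar ≤ U)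
    (hα0 : 0 ≤ α) (hα1 : α ≤ 1) (hξ0 : 0 ≤ ξ) (hξ1 : ξ ≤ 1)
    (hloss : ∀ t, 0 ≤ 1 + euclNorm ((Lseq t).mulVec (x t - p t)) ^ 2 -
      euclNorm ((Lseq t).mulVec (x t - q t)) ^ 2)
    (h1 : ∀ t, 0 ≤ edot ((Lseq t).mulVec (x t)) ((Lseq t).mulVec (p t)))
    (h4 : ∀ t, edot ((Lseq t).mulVec (x t)) ((Lseq t).mulVec (q t)) ≤ 0)
    (h2 : ∀ t, edot (Lstar.mulVec (x t)) (Lstar.mulVec (p t)) ≤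
      α * euclNorm (Lstar.mulVec (x t)) * euclNorm (Lstar.mulVec (p t)))
    (h3 : ∀ t, -(ξ * euclNorm (Lstar.mulVec (x t)) * euclNorm (Lstar.mulVec (q t))) ≤
      edot (Lstar.mulVec (x t)) (Lstar.mulVec (q t))) :
    (∑ t, max 0 (1 + euclNorm ((Lseq t).mulVec (x t - p t)) ^ 2 -
        euclNorm ((Lseq t).mulVec (x t - q t)) ^ 2)) -
      (∑ t, max 0 (1 + euclNorm (Lstar.mulVec (x t - p t)) ^ 2 -
        euclNorm (Lstar.mulVec (x t - q t)) ^ 2)) ≤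
      2 * (T : ℝ) * (α + ξ + 1) * R ^ 2 * U ^ 2 := by
  rw [← Finset.sum_sub_distrib]
  have key : ∀ t ∈ (Finset.univ : Finset (Fin T)),
      max 0 (1 + euclNorm ((Lseq t).mulVec (x t - p t)) ^ 2 -
        euclNorm ((Lseq t).mulVec (x t - q t)) ^ 2) -
      max 0 (1 + euclNorm (Lstar.mulVec (x t - p t)) ^ 2 -
        euclNorm (Lstar.mulVec (x t - q t)) ^ 2) ≤ 2 * (α + ξ + 1) * (U * R) ^ 2 := by
    intro t _
    rw [max_eq_right (hloss t)]
    have hm := le_max_right 0 (1 + euclNorm (Lstar.mulVec (x t - p t)) ^ 2 -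
        euclNorm (Lstar.mulVec (x t - q t)) ^ 2)
    have e1 := euclNorm_mulVec_sub_sq (Lseq t) (x t) (p t)
    have e2 := euclNorm_mulVec_sub_sq (Lseq t) (x t) (q t)
    have e3 := euclNorm_mulVec_sub_sq Lstar (x t) (p t)
    have e4 := euclNorm_mulVec_sub_sq Lstar (x t) (q t)
    have b1 := pow_le_pow_left₀ (euclNorm_nonneg _) (euclNorm_mulVec_le' (hL t) (hp t)) 2
    have b2 := pow_le_pow_left₀ (euclNorm_nonneg _) (euclNorm_mulVec_le' hLstar (hq t)) 2
    have bx := euclNorm_mulVec_le' hLstar (hx t)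
    have h0 : 0 ≤ U * R := (euclNorm_nonneg _).trans bx
    have c1 := mul_le_mul_of_nonneg_left
      (mul_le_mul bx (euclNorm_mulVec_le' hLstar (hp t)) (euclNorm_nonneg _) h0) hα0
    have c2 := mul_le_mul_of_nonneg_left
      (mul_le_mul bx (euclNorm_mulVec_le' hLstar (hq t)) (euclNorm_nonneg _) h0) hξ0
    have n1 := sq_nonneg (euclNorm ((Lseq t).mulVec (q t)))
    have n2 := sq_nonneg (euclNorm (Lstar.mulVec (p t)))
    have i1 := h1 t
    have i2 := h2 t
    have i3 := h3 t
    have i4 := h4 t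
    rw [mul_assoc] at i2 i3
    linarith
  refine (Finset.sum_le_sum key).trans (le_of_eq ?_)
  simp only [Finset.sum_const, Finset.card_univ, Fintype.card_fin, nsmul_eq_mul]
  ring
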